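/- There exist two polynomials P and Q in 10 variables with rational coefficients, homogeneous of degrees 4 and 6 respectively, such that for every ternary cubic form f over ℝ, writing I(f) = P(coefficients of f) and J(f) = Q(coefficients of f), one has the identity of ternary cubic forms H(H(f)) = 12288·I(f)²·f + 512·J(f)·H(f). -/

import Mathlib

open MvPolynomial

/-- The Hessian of a ternary form: the determinant of the matrix of second partials. -/
noncomputable def hess {R : Type*} [CommRing R] (f : MvPolynomial (Fin 3) R) :
    MvPolynomial (Fin 3) R :=
  Matrix.det (Matrix.of fun i j => pderiv i (pderiv j f))

/-- The exponent vectors of the ten monomials of a ternary cubic form. -/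
def expo : Fin 10 → Fin 3 → ℕ :=
  ![![3,0,0], ![0,3,0], ![0,0,3], ![2,1,0], ![2,0,1],
    ![1,2,0], ![0,2,1], ![1,0,2], ![0,1,2], ![1,1,1]]

/-- The ternary cubic form with coefficient vector `c : Fin 10 → R`. -/
noncomputable def cubic {R : Type*} [CommRing R] (c : Fin 10 → R) : MvPolynomial (Fin 3) R :=
  ∑ k : Fin 10, C (c k) * ∏ i : Fin 3, X i ^ expo k i

/-- Terms of the degree 4 invariant. -/
def termsI : List (ℚ × List (Fin 10)) :=
  [(27/2, [0, 1, 2, 9]), (-9, [0, 1, 7, 8]), (-9, [0, 2, 5, 6]), (3, [0, 5, 8, 8]),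
  (3, [0, 6, 6, 7]), (-3/2, [0, 6, 8, 9]), (-9, [1, 2, 3, 4]), (3, [1, 3, 7, 7]),
  (3, [1, 4, 4, 8]), (-3/2, [1, 4, 7, 9]), (3, [2, 3, 3, 6]), (-3/2, [2, 3, 5, 9]),
  (3, [2, 4, 5, 5]), (-1, [3, 3, 8, 8]), (1, [3, 4, 6, 8]), (1, [3, 5, 7, 8]),
  (-3/2, [3, 6, 7, 9]), (1/2, [3, 8, 9, 9]), (-1, [4, 4, 6, 6]), (1, [4, 5, 6, 7]),
  (-3/2, [4, 5, 8, 9]), (1/2, [4, 6, 9, 9]), (-1, [5, 5, 7, 7]), (1/2, [5, 7, 9, 9]),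
  (-1/16, [9, 9, 9, 9])]

/-- Terms of the degree 6 invariant. -/
def termsJ : List (ℚ × List (Fin 10)) :=
  [(729/4, [0, 0, 1, 1, 2, 2]), (-243/2, [0, 0, 1, 2, 6, 8]), (27, [0, 0, 1, 8, 8, 8]), (27, [0, 0, 2, 6, 6, 6]),
  (-27/4, [0, 0, 6, 6, 8, 8]), (-243/2, [0, 1, 1, 2, 4, 7]), (27, [0, 1, 1, 7, 7, 7]), (-243/2, [0, 1, 2, 2, 3, 5]),
  (81/2, [0, 1, 2, 3, 6, 7]), (81/2, [0, 1, 2, 3, 8, 9]), (81/2, [0, 1, 2, 4, 5, 8]), (81/2, [0, 1, 2, 4, 6, 9]),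
  (81/2, [0, 1, 2, 5, 7, 9]), (-135/8, [0, 1, 2, 9, 9, 9]), (-27, [0, 1, 3, 7, 8, 8]), (81/2, [0, 1, 4, 6, 7, 8]),
  (-27, [0, 1, 4, 8, 8, 9]), (-27, [0, 1, 5, 7, 7, 8]), (-27, [0, 1, 6, 7, 7, 9]), (81/4, [0, 1, 7, 8, 9, 9]),
  (27, [0, 2, 2, 5, 5, 5]), (81/2, [0, 2, 3, 5, 6, 8]), (-27, [0, 2, 3, 6, 6, 9]), (-27, [0, 2, 4, 5, 6, 6]),
  (-27, [0, 2, 5, 5, 6, 7]), (-27, [0, 2, 5, 5, 8, 9]), (81/4, [0, 2, 5, 6, 9, 9]), (-9, [0, 3, 5, 8, 8, 8]),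
  (9/2, [0, 3, 6, 6, 7, 8]), (9/2, [0, 3, 6, 8, 8, 9]), (9/2, [0, 4, 5, 6, 8, 8]), (-9, [0, 4, 6, 6, 6, 7]),
  (9/2, [0, 4, 6, 6, 8, 9]), (18, [0, 5, 5, 7, 8, 8]), (18, [0, 5, 6, 6, 7, 7]), (-45/2, [0, 5, 6, 7, 8, 9]),
  (9/4, [0, 5, 8, 8, 9, 9]), (9/4, [0, 6, 6, 7, 9, 9]), (-9/8, [0, 6, 8, 9, 9, 9]), (27, [1, 1, 2, 4, 4, 4]),
  (-27/4, [1, 1, 4, 4, 7, 7]), (27, [1, 2, 2, 3, 3, 3]), (-27, [1, 2, 3, 3, 4, 8]), (-27, [1, 2, 3, 3, 7, 9]),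
  (-27, [1, 2, 3, 4, 4, 6]), (81/2, [1, 2, 3, 4, 5, 7]), (81/4, [1, 2, 3, 4, 9, 9]), (-27, [1, 2, 4, 4, 5, 9]),
  (18, [1, 3, 3, 7, 7, 8]), (18, [1, 3, 4, 4, 8, 8]), (9/2, [1, 3, 4, 6, 7, 7]), (-45/2, [1, 3, 4, 7, 8, 9]),
  (-9, [1, 3, 5, 7, 7, 7]), (9/4, [1, 3, 7, 7, 9, 9]), (-9, [1, 4, 4, 4, 6, 8]), (9/2, [1, 4, 4, 5, 7, 8]),
  (9/2, [1, 4, 4, 6, 7, 9]), (9/4, [1, 4, 4, 8, 9, 9]), (9/2, [1, 4, 5, 7, 7, 9]), (-9/8, [1, 4, 7, 9, 9, 9]),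
  (-27/4, [2, 2, 3, 3, 5, 5]), (-9, [2, 3, 3, 3, 6, 8]), (18, [2, 3, 3, 4, 6, 6]), (9/2, [2, 3, 3, 5, 6, 7]),
  (9/2, [2, 3, 3, 5, 8, 9]), (9/4, [2, 3, 3, 6, 9, 9]), (9/2, [2, 3, 4, 5, 5, 8]), (-45/2, [2, 3, 4, 5, 6, 9]),
  (9/2, [2, 3, 5, 5, 7, 9]), (-9/8, [2, 3, 5, 9, 9, 9]), (18, [2, 4, 4, 5, 5, 6]), (-9, [2, 4, 5, 5, 5, 7]),
  (9/4, [2, 4, 5, 5, 9, 9]), (2, [3, 3, 3, 8, 8, 8]), (-3, [3, 3, 4, 6, 8, 8]), (-3, [3, 3, 5, 7, 8, 8]),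
  (-27/4, [3, 3, 6, 6, 7, 7]), (9/2, [3, 3, 6, 7, 8, 9]), (-3/2, [3, 3, 8, 8, 9, 9]), (-3, [3, 4, 4, 6, 6, 8]),
  (-3/2, [3, 4, 5, 6, 7, 8]), (9/2, [3, 4, 5, 8, 8, 9]), (9/2, [3, 4, 6, 6, 7, 9]), (-3/4, [3, 4, 6, 8, 9, 9]),
  (-3, [3, 5, 5, 7, 7, 8]), (9/2, [3, 5, 6, 7, 7, 9]), (-3/4, [3, 5, 7, 8, 9, 9]), (-9/8, [3, 6, 7, 9, 9, 9]),
  (3/8, [3, 8, 9, 9, 9, 9]), (2, [4, 4, 4, 6, 6, 6]), (-27/4, [4, 4, 5, 5, 8, 8]), (-3, [4, 4, 5, 6, 6, 7]),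
  (9/2, [4, 4, 5, 6, 8, 9]), (-3/2, [4, 4, 6, 6, 9, 9]), (-3, [4, 5, 5, 6, 7, 7]), (9/2, [4, 5, 5, 7, 8, 9]),
  (-3/4, [4, 5, 6, 7, 9, 9]), (-9/8, [4, 5, 8, 9, 9, 9]), (3/8, [4, 6, 9, 9, 9, 9]), (2, [5, 5, 5, 7, 7, 7]),
  (-3/2, [5, 5, 7, 7, 9, 9]), (3/8, [5, 7, 9, 9, 9, 9]), (-1/32, [9, 9, 9, 9, 9, 9])]

/-- The polynomial with the given list of terms. -/
noncomputable def polyOf (L : List (ℚ × List (Fin 10))) : MvPolynomial (Fin 10) ℚ :=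
  (L.map fun t => C t.1 * (t.2.map X).prod).sum

theorem polyOf_homog (n : ℕ) (L : List (ℚ × List (Fin 10))) (h : ∀ t ∈ L, t.2.length = n) :
    (polyOf L).IsHomogeneous n := by
  have key : ∀ l : List (Fin 10),
      ((l.map X).prod : MvPolynomial (Fin 10) ℚ).IsHomogeneous l.length := by
    intro l
    induction l with
    | nil => simpa using isHomogeneous_one (Fin 10) ℚ
    | cons a l ih =>
      rw [List.map_cons, List.prod_cons, List.length_cons, add_comm]
      exact (isHomogeneous_X ℚ a).mul ih
  induction L with
  | nil => simpa [polyOf] using isHomogeneous_zero (Fin 10) ℚ n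
  | cons t L ih =>
    have h1 : polyOf (t :: L) = C t.1 * (t.2.map X).prod + polyOf L := by simp [polyOf]
    rw [h1]
    refine IsHomogeneous.add ?_ (ih fun s hs => h s (List.mem_cons_of_mem _ hs))
    have h2 := h t List.mem_cons_self
    rw [← h2]
    exact (key t.2).C_mul t.1

theorem aeval_polyOf (L : List (ℚ × List (Fin 10))) (c : Fin 10 → ℝ) :
    aeval c (polyOf L) = (L.map fun t => (t.1 : ℝ) * (t.2.map c).prod).sum := by
  induction L with
  | nil => simp [polyOf]
  | cons t L ih =>
    have h1 : polyOf (t :: L) = C t.1 * (t.2.map X).prod + polyOf L := by simp [polyOf]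
    rw [h1, map_add, ih, map_mul, map_list_prod, List.map_map]
    simp [Function.comp_def]

/-- Coefficients of the Hessian. -/
def hc {R : Type*} [CommRing R] (c : Fin 10 → R) : Fin 10 → R := ![
  (24)*(c 0*c 5*c 7) + (-6)*(c 0*c 9*c 9) + (-8)*(c 3*c 3*c 7) + (8)*(c 3*c 4*c 9) +
    (-8)*(c 4*c 4*c 5),
  (24)*(c 1*c 3*c 8) + (-6)*(c 1*c 9*c 9) + (-8)*(c 3*c 6*c 6) + (-8)*(c 5*c 5*c 8) +
    (8)*(c 5*c 6*c 9),
  (24)*(c 2*c 4*c 6) + (-6)*(c 2*c 9*c 9) + (-8)*(c 4*c 8*c 8) + (-8)*(c 6*c 7*c 7) +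
    (8)*(c 7*c 8*c 9),
  (72)*(c 0*c 1*c 7) + (24)*(c 0*c 5*c 8) + (-24)*(c 0*c 6*c 9) + (-24)*(c 1*c 4*c 4) +
    (-8)*(c 3*c 3*c 8) + (16)*(c 3*c 4*c 6) + (-8)*(c 3*c 5*c 7) + (2)*(c 3*c 9*c 9),
  (72)*(c 0*c 2*c 5) + (24)*(c 0*c 6*c 7) + (-24)*(c 0*c 8*c 9) + (-24)*(c 2*c 3*c 3) +
    (16)*(c 3*c 4*c 8) + (-8)*(c 4*c 4*c 6) + (-8)*(c 4*c 5*c 7) + (2)*(c 4*c 9*c 9),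
  (72)*(c 0*c 1*c 8) + (-24)*(c 0*c 6*c 6) + (24)*(c 1*c 3*c 7) + (-24)*(c 1*c 4*c 9) +
    (-8)*(c 3*c 5*c 8) + (16)*(c 4*c 5*c 6) + (-8)*(c 5*c 5*c 7) + (2)*(c 5*c 9*c 9),
  (72)*(c 1*c 2*c 3) + (24)*(c 1*c 4*c 8) + (-24)*(c 1*c 7*c 9) + (-24)*(c 2*c 5*c 5) +
    (-8)*(c 3*c 6*c 8) + (-8)*(c 4*c 6*c 6) + (16)*(c 5*c 6*c 7) + (2)*(c 6*c 9*c 9),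
  (72)*(c 0*c 2*c 6) + (-24)*(c 0*c 8*c 8) + (-24)*(c 2*c 3*c 9) + (24)*(c 2*c 4*c 5) +
    (16)*(c 3*c 7*c 8) + (-8)*(c 4*c 6*c 7) + (-8)*(c 5*c 7*c 7) + (2)*(c 7*c 9*c 9),
  (72)*(c 1*c 2*c 4) + (-24)*(c 1*c 7*c 7) + (24)*(c 2*c 3*c 6) + (-24)*(c 2*c 5*c 9) +
    (-8)*(c 3*c 8*c 8) + (-8)*(c 4*c 6*c 8) + (16)*(c 5*c 7*c 8) + (2)*(c 8*c 9*c 9),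
  (216)*(c 0*c 1*c 2) + (-24)*(c 0*c 6*c 8) + (-24)*(c 1*c 4*c 7) + (-24)*(c 2*c 3*c 5) +
    (24)*(c 3*c 6*c 7) + (-8)*(c 3*c 8*c 9) + (24)*(c 4*c 5*c 8) + (-8)*(c 4*c 6*c 9) +
    (-8)*(c 5*c 7*c 9) + (2)*(c 9*c 9*c 9)]

/-- The value of the degree 4 invariant. -/
noncomputable def valI (c : Fin 10 → ℝ) : ℝ :=
    (27/2)*(c 0*c 1*c 2*c 9) + (-9)*(c 0*c 1*c 7*c 8) + (-9)*(c 0*c 2*c 5*c 6) + (3)*(c 0*c 5*c 8*c 8) +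
    (3)*(c 0*c 6*c 6*c 7) + (-3/2)*(c 0*c 6*c 8*c 9) + (-9)*(c 1*c 2*c 3*c 4) + (3)*(c 1*c 3*c 7*c 7) +
    (3)*(c 1*c 4*c 4*c 8) + (-3/2)*(c 1*c 4*c 7*c 9) + (3)*(c 2*c 3*c 3*c 6) + (-3/2)*(c 2*c 3*c 5*c 9) +
    (3)*(c 2*c 4*c 5*c 5) + (-1)*(c 3*c 3*c 8*c 8) + (1)*(c 3*c 4*c 6*c 8) + (1)*(c 3*c 5*c 7*c 8) +
    (-3/2)*(c 3*c 6*c 7*c 9) + (1/2)*(c 3*c 8*c 9*c 9) + (-1)*(c 4*c 4*c 6*c 6) + (1)*(c 4*c 5*c 6*c 7) +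
    (-3/2)*(c 4*c 5*c 8*c 9) + (1/2)*(c 4*c 6*c 9*c 9) + (-1)*(c 5*c 5*c 7*c 7) + (1/2)*(c 5*c 7*c 9*c 9) +
    (-1/16)*(c 9*c 9*c 9*c 9)

/-- The value of the degree 6 invariant. -/
noncomputable def valJ (c : Fin 10 → ℝ) : ℝ :=
    (729/4)*(c 0*c 0*c 1*c 1*c 2*c 2) + (-243/2)*(c 0*c 0*c 1*c 2*c 6*c 8) + (27)*(c 0*c 0*c 1*c 8*c 8*c 8) + (27)*(c 0*c 0*c 2*c 6*c 6*c 6) +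
    (-27/4)*(c 0*c 0*c 6*c 6*c 8*c 8) + (-243/2)*(c 0*c 1*c 1*c 2*c 4*c 7) + (27)*(c 0*c 1*c 1*c 7*c 7*c 7) + (-243/2)*(c 0*c 1*c 2*c 2*c 3*c 5) +
    (81/2)*(c 0*c 1*c 2*c 3*c 6*c 7) + (81/2)*(c 0*c 1*c 2*c 3*c 8*c 9) + (81/2)*(c 0*c 1*c 2*c 4*c 5*c 8) + (81/2)*(c 0*c 1*c 2*c 4*c 6*c 9) +
    (81/2)*(c 0*c 1*c 2*c 5*c 7*c 9) + (-135/8)*(c 0*c 1*c 2*c 9*c 9*c 9) + (-27)*(c 0*c 1*c 3*c 7*c 8*c 8) + (81/2)*(c 0*c 1*c 4*c 6*c 7*c 8) +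
    (-27)*(c 0*c 1*c 4*c 8*c 8*c 9) + (-27)*(c 0*c 1*c 5*c 7*c 7*c 8) + (-27)*(c 0*c 1*c 6*c 7*c 7*c 9) + (81/4)*(c 0*c 1*c 7*c 8*c 9*c 9) +
    (27)*(c 0*c 2*c 2*c 5*c 5*c 5) + (81/2)*(c 0*c 2*c 3*c 5*c 6*c 8) + (-27)*(c 0*c 2*c 3*c 6*c 6*c 9) + (-27)*(c 0*c 2*c 4*c 5*c 6*c 6) +
    (-27)*(c 0*c 2*c 5*c 5*c 6*c 7) + (-27)*(c 0*c 2*c 5*c 5*c 8*c 9) + (81/4)*(c 0*c 2*c 5*c 6*c 9*c 9) + (-9)*(c 0*c 3*c 5*c 8*c 8*c 8) +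
    (9/2)*(c 0*c 3*c 6*c 6*c 7*c 8) + (9/2)*(c 0*c 3*c 6*c 8*c 8*c 9) + (9/2)*(c 0*c 4*c 5*c 6*c 8*c 8) + (-9)*(c 0*c 4*c 6*c 6*c 6*c 7) +
    (9/2)*(c 0*c 4*c 6*c 6*c 8*c 9) + (18)*(c 0*c 5*c 5*c 7*c 8*c 8) + (18)*(c 0*c 5*c 6*c 6*c 7*c 7) + (-45/2)*(c 0*c 5*c 6*c 7*c 8*c 9) +
    (9/4)*(c 0*c 5*c 8*c 8*c 9*c 9) + (9/4)*(c 0*c 6*c 6*c 7*c 9*c 9) + (-9/8)*(c 0*c 6*c 8*c 9*c 9*c 9) + (27)*(c 1*c 1*c 2*c 4*c 4*c 4) +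
    (-27/4)*(c 1*c 1*c 4*c 4*c 7*c 7) + (27)*(c 1*c 2*c 2*c 3*c 3*c 3) + (-27)*(c 1*c 2*c 3*c 3*c 4*c 8) + (-27)*(c 1*c 2*c 3*c 3*c 7*c 9) +
    (-27)*(c 1*c 2*c 3*c 4*c 4*c 6) + (81/2)*(c 1*c 2*c 3*c 4*c 5*c 7) + (81/4)*(c 1*c 2*c 3*c 4*c 9*c 9) + (-27)*(c 1*c 2*c 4*c 4*c 5*c 9) +
    (18)*(c 1*c 3*c 3*c 7*c 7*c 8) + (18)*(c 1*c 3*c 4*c 4*c 8*c 8) + (9/2)*(c 1*c 3*c 4*c 6*c 7*c 7) + (-45/2)*(c 1*c 3*c 4*c 7*c 8*c 9) +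
    (-9)*(c 1*c 3*c 5*c 7*c 7*c 7) + (9/4)*(c 1*c 3*c 7*c 7*c 9*c 9) + (-9)*(c 1*c 4*c 4*c 4*c 6*c 8) + (9/2)*(c 1*c 4*c 4*c 5*c 7*c 8) +
    (9/2)*(c 1*c 4*c 4*c 6*c 7*c 9) + (9/4)*(c 1*c 4*c 4*c 8*c 9*c 9) + (9/2)*(c 1*c 4*c 5*c 7*c 7*c 9) + (-9/8)*(c 1*c 4*c 7*c 9*c 9*c 9) +
    (-27/4)*(c 2*c 2*c 3*c 3*c 5*c 5) + (-9)*(c 2*c 3*c 3*c 3*c 6*c 8) + (18)*(c 2*c 3*c 3*c 4*c 6*c 6) + (9/2)*(c 2*c 3*c 3*c 5*c 6*c 7) +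
    (9/2)*(c 2*c 3*c 3*c 5*c 8*c 9) + (9/4)*(c 2*c 3*c 3*c 6*c 9*c 9) + (9/2)*(c 2*c 3*c 4*c 5*c 5*c 8) + (-45/2)*(c 2*c 3*c 4*c 5*c 6*c 9) +
    (9/2)*(c 2*c 3*c 5*c 5*c 7*c 9) + (-9/8)*(c 2*c 3*c 5*c 9*c 9*c 9) + (18)*(c 2*c 4*c 4*c 5*c 5*c 6) + (-9)*(c 2*c 4*c 5*c 5*c 5*c 7) +
    (9/4)*(c 2*c 4*c 5*c 5*c 9*c 9) + (2)*(c 3*c 3*c 3*c 8*c 8*c 8) + (-3)*(c 3*c 3*c 4*c 6*c 8*c 8) + (-3)*(c 3*c 3*c 5*c 7*c 8*c 8) +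
    (-27/4)*(c 3*c 3*c 6*c 6*c 7*c 7) + (9/2)*(c 3*c 3*c 6*c 7*c 8*c 9) + (-3/2)*(c 3*c 3*c 8*c 8*c 9*c 9) + (-3)*(c 3*c 4*c 4*c 6*c 6*c 8) +
    (-3/2)*(c 3*c 4*c 5*c 6*c 7*c 8) + (9/2)*(c 3*c 4*c 5*c 8*c 8*c 9) + (9/2)*(c 3*c 4*c 6*c 6*c 7*c 9) + (-3/4)*(c 3*c 4*c 6*c 8*c 9*c 9) +
    (-3)*(c 3*c 5*c 5*c 7*c 7*c 8) + (9/2)*(c 3*c 5*c 6*c 7*c 7*c 9) + (-3/4)*(c 3*c 5*c 7*c 8*c 9*c 9) + (-9/8)*(c 3*c 6*c 7*c 9*c 9*c 9) +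
    (3/8)*(c 3*c 8*c 9*c 9*c 9*c 9) + (2)*(c 4*c 4*c 4*c 6*c 6*c 6) + (-27/4)*(c 4*c 4*c 5*c 5*c 8*c 8) + (-3)*(c 4*c 4*c 5*c 6*c 6*c 7) +
    (9/2)*(c 4*c 4*c 5*c 6*c 8*c 9) + (-3/2)*(c 4*c 4*c 6*c 6*c 9*c 9) + (-3)*(c 4*c 5*c 5*c 6*c 7*c 7) + (9/2)*(c 4*c 5*c 5*c 7*c 8*c 9) +
    (-3/4)*(c 4*c 5*c 6*c 7*c 9*c 9) + (-9/8)*(c 4*c 5*c 8*c 9*c 9*c 9) + (3/8)*(c 4*c 6*c 9*c 9*c 9*c 9) + (2)*(c 5*c 5*c 5*c 7*c 7*c 7) +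
    (-3/2)*(c 5*c 5*c 7*c 7*c 9*c 9) + (3/8)*(c 5*c 7*c 9*c 9*c 9*c 9) + (-1/32)*(c 9*c 9*c 9*c 9*c 9*c 9)

theorem eval_I (c : Fin 10 → ℝ) : aeval c (polyOf termsI) = valI c := by
  rw [aeval_polyOf]
  simp only [termsI, valI, List.map_cons, List.map_nil, List.sum_cons, List.sum_nil,
    List.prod_cons, List.prod_nil]
  push_cast
  ring

set_option maxHeartbeats 4000000 in
theorem eval_J (c : Fin 10 → ℝ) : aeval c (polyOf termsJ) = valJ c := by
  rw [aeval_polyOf]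
  simp only [termsJ, valJ, List.map_cons, List.map_nil, List.sum_cons, List.sum_nil,
    List.prod_cons, List.prod_nil]
  push_cast
  ring

theorem cubic_explicit {R : Type*} [CommRing R] (c : Fin 10 → R) : cubic c =
    C (c 0) * X 0 ^ 3 + C (c 1) * X 1 ^ 3 + C (c 2) * X 2 ^ 3
    + C (c 3) * (X 0 ^ 2 * X 1) + C (c 4) * (X 0 ^ 2 * X 2)
    + C (c 5) * (X 0 * X 1 ^ 2) + C (c 6) * (X 1 ^ 2 * X 2)
    + C (c 7) * (X 0 * X 2 ^ 2) + C (c 8) * (X 1 * X 2 ^ 2)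
    + C (c 9) * (X 0 * X 1 * X 2) := by
  have h : cubic c = ∑ k : Fin 10, C (c k) * (X 0 ^ expo k 0 * X 1 ^ expo k 1 * X 2 ^ expo k 2) := by
    simp only [cubic, Fin.prod_univ_three]
  rw [h, Fin.sum_univ_castSucc, Fin.sum_univ_castSucc, Fin.sum_univ_eight]
  change C (c 0) * (X 0 ^ 3 * X 1 ^ 0 * X 2 ^ 0) + C (c 1) * (X 0 ^ 0 * X 1 ^ 3 * X 2 ^ 0)
    + C (c 2) * (X 0 ^ 0 * X 1 ^ 0 * X 2 ^ 3) + C (c 3) * (X 0 ^ 2 * X 1 ^ 1 * X 2 ^ 0)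
    + C (c 4) * (X 0 ^ 2 * X 1 ^ 0 * X 2 ^ 1) + C (c 5) * (X 0 ^ 1 * X 1 ^ 2 * X 2 ^ 0)
    + C (c 6) * (X 0 ^ 0 * X 1 ^ 2 * X 2 ^ 1) + C (c 7) * (X 0 ^ 1 * X 1 ^ 0 * X 2 ^ 2)
    + C (c 8) * (X 0 ^ 0 * X 1 ^ 1 * X 2 ^ 2) + C (c 9) * (X 0 ^ 1 * X 1 ^ 1 * X 2 ^ 1) = _
  simp only [pow_zero, pow_one, mul_one, one_mul]

set_option maxRecDepth 100000 in
set_option maxHeartbeats 4000000 in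
theorem hess_cubic (c : Fin 10 → ℝ) : hess (cubic c) = cubic (hc c) := by
  have d2 : ∀ i : Fin 3, pderiv i (2 : MvPolynomial (Fin 3) ℝ) = 0 := fun i => by
    rw [← map_ofNat (C : ℝ →+* MvPolynomial (Fin 3) ℝ) 2]; exact pderiv_C
  have d3 : ∀ i : Fin 3, pderiv i (3 : MvPolynomial (Fin 3) ℝ) = 0 := fun i => by
    rw [← map_ofNat (C : ℝ →+* MvPolynomial (Fin 3) ℝ) 3]; exact pderiv_C
  rw [cubic_explicit, cubic_explicit, hess, Matrix.det_fin_three]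
  simp only [Matrix.of_apply, map_add, Derivation.leibniz, Derivation.leibniz_pow, pderiv_C,
    smul_eq_mul, nsmul_eq_mul, Fin.isValue, pderiv_X, Pi.single_apply, Fin.reduceEq, if_true,
    if_false, map_zero, mul_zero, mul_one, add_zero, zero_add, Nat.cast_ofNat, d2, d3]
  simp [hc]
  simp only [map_ofNat]
  ring1

set_option maxHeartbeats 4000000 in
theorem key0 (c : Fin 10 → ℝ) :
    hc (hc c) 0 = 12288 * valI c ^ 2 * c 0 + 512 * valJ c * hc c 0 := by
  simp [hc, valI, valJ]
  ring

set_option maxHeartbeats 4000000 in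
theorem key1 (c : Fin 10 → ℝ) :
    hc (hc c) 1 = 12288 * valI c ^ 2 * c 1 + 512 * valJ c * hc c 1 := by
  simp [hc, valI, valJ]
  ring

set_option maxHeartbeats 4000000 in
theorem key2 (c : Fin 10 → ℝ) :
    hc (hc c) 2 = 12288 * valI c ^ 2 * c 2 + 512 * valJ c * hc c 2 := by
  simp [hc, valI, valJ]
  ring

set_option maxHeartbeats 4000000 in
theorem key3 (c : Fin 10 → ℝ) :
    hc (hc c) 3 = 12288 * valI c ^ 2 * c 3 + 512 * valJ c * hc c 3 := by
  simp [hc, valI, valJ]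
  ring

set_option maxHeartbeats 4000000 in
theorem key4 (c : Fin 10 → ℝ) :
    hc (hc c) 4 = 12288 * valI c ^ 2 * c 4 + 512 * valJ c * hc c 4 := by
  simp [hc, valI, valJ]
  ring

set_option maxHeartbeats 4000000 in
theorem key5 (c : Fin 10 → ℝ) :
    hc (hc c) 5 = 12288 * valI c ^ 2 * c 5 + 512 * valJ c * hc c 5 := by
  simp [hc, valI, valJ]
  ring

set_option maxHeartbeats 4000000 in
theorem key6 (c : Fin 10 → ℝ) :
    hc (hc c) 6 = 12288 * valI c ^ 2 * c 6 + 512 * valJ c * hc c 6 := by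
  simp [hc, valI, valJ]
  ring

set_option maxHeartbeats 4000000 in
theorem key7 (c : Fin 10 → ℝ) :
    hc (hc c) 7 = 12288 * valI c ^ 2 * c 7 + 512 * valJ c * hc c 7 := by
  simp [hc, valI, valJ]
  ring

set_option maxHeartbeats 4000000 in
theorem key8 (c : Fin 10 → ℝ) :
    hc (hc c) 8 = 12288 * valI c ^ 2 * c 8 + 512 * valJ c * hc c 8 := by
  simp [hc, valI, valJ]
  ring

set_option maxHeartbeats 4000000 in
theorem key9 (c : Fin 10 → ℝ) :
    hc (hc c) 9 = 12288 * valI c ^ 2 * c 9 + 512 * valJ c * hc c 9 := by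
  simp [hc, valI, valJ]
  ring

/-- There exist two polynomials `P` and `Q` in 10 variables with rational coefficients,
homogeneous of degrees 4 and 6 respectively, such that for every ternary cubic form `f`
over `ℝ`, with `I(f) = P(coefficients of f)` and `J(f) = Q(coefficients of f)`, one has
`H(H(f)) = 12288·I(f)²·f + 512·J(f)·H(f)`. -/
theorem stmt1 :
    ∃ P Q : MvPolynomial (Fin 10) ℚ, P.IsHomogeneous 4 ∧ Q.IsHomogeneous 6 ∧
      ∀ c : Fin 10 → ℝ,
        hess (hess (cubic c)) =
          12288 * C ((aeval c) P) ^ 2 * cubic c + 512 * C ((aeval c) Q) * hess (cubic c) := by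
  refine ⟨polyOf termsI, polyOf termsJ, polyOf_homog 4 _ (by decide), polyOf_homog 6 _ (by decide),
    fun c => ?_⟩
  rw [eval_I, eval_J, hess_cubic, hess_cubic, cubic_explicit (hc (hc c)), cubic_explicit c,
    cubic_explicit (hc c), key0, key1, key2, key3, key4, key5, key6, key7, key8, key9]
  simp only [map_add, map_mul, map_pow, map_ofNat]
  ring
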